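/- Let H = ((α, −β), (β, α)) be a 2×2 real matrix with α > 0, and let A be a symmetric positive definite 2×2 real matrix. Then every eigenvalue λ ∈ ℂ of H⁻¹A has positive real part. -/

import Mathlib

open Matrix

lemma quad_pos_aux (a b c x y : ℝ) (ha : 0 < a) (hd : 0 < a * c - b * b) (h : x ≠ 0 ∨ y ≠ 0) :
    0 < a * x ^ 2 + 2 * b * x * y + c * y ^ 2 := by
  have e : a * (a * x ^ 2 + 2 * b * x * y + c * y ^ 2)
      = (a * x + b * y) ^ 2 + (a * c - b * b) * y ^ 2 := by ring
  refine pos_of_mul_pos_right (a := a) ?_ ha.le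
  rw [e]
  by_cases hy : y = 0
  · have hx : x ≠ 0 := by simpa [hy] using h
    subst hy
    simp only [mul_zero, add_zero]
    positivity
  · have : 0 < y ^ 2 := by positivity
    positivity

/-- Every eigenvalue of H⁻¹A has positive real part, where H = [[α,−β],[β,α]]
    with α > 0 and A is symmetric positive definite. -/
theorem eigenvalues_pos_re
    (α β : ℝ) (hα : 0 < α)
    (A : Matrix (Fin 2) (Fin 2) ℝ) (hA : A.PosDef) :
    ∀ (lam : ℂ) (v : Fin 2 → ℂ), v ≠ 0 →
      (((!![α, -β; β, α])⁻¹ * A).map (fun x : ℝ => (x : ℂ))).mulVec v = lam • v →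
      0 < lam.re := by
  intro lam v hv h
  have ha : 0 < A 0 0 := hA.diag_pos
  have hs : A 1 0 = A 0 1 := by simpa using hA.1.apply 0 1
  have hd : 0 < A 0 0 * A 1 1 - A 0 1 * A 0 1 := by
    have := hA.det_pos
    rw [Matrix.det_fin_two, hs] at this
    exact this
  have hH : IsUnit (!![α, -β; β, α]).det := by
    rw [Matrix.det_fin_two_of, isUnit_iff_ne_zero]
    nlinarith [mul_pos hα hα, mul_self_nonneg β]
  have key : (A.map (Complex.ofRealHom)).mulVec v
      = lam • ((!![α, -β; β, α]).map Complex.ofRealHom).mulVec v := by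
    rw [← Matrix.mulVec_smul]
    change _ = ((!![α, -β; β, α]).map Complex.ofRealHom).mulVec (lam • v)
    rw [← h]
    change _ = ((!![α, -β; β, α]).map Complex.ofRealHom).mulVec
      ((((!![α, -β; β, α])⁻¹ * A).map Complex.ofRealHom).mulVec v)
    rw [Matrix.mulVec_mulVec, ← Matrix.map_mul, Matrix.mul_nonsing_inv_cancel_left _ _ hH]
  have k0 := congrFun key 0
  have k1 := congrFun key 1
  simp [Matrix.mulVec, dotProduct, Fin.sum_univ_two, hs] at k0 k1
  generalize A 0 0 = a at *
  generalize A 0 1 = b at *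
  generalize A 1 1 = c at *
  have hv' : v 0 ≠ 0 ∨ v 1 ≠ 0 := by
    by_contra hc
    push Not at hc
    exact hv (by ext i; fin_cases i <;> simp [hc.1, hc.2])
  clear key h hv
  generalize v 0 = z at *
  generalize v 1 = w at *
  obtain ⟨x, x'⟩ := z
  obtain ⟨y, y'⟩ := w
  obtain ⟨l, m⟩ := lam
  simp [Complex.ext_iff] at k0 k1 hv' ⊢
  obtain ⟨p1, p2⟩ := k0
  obtain ⟨q1, q2⟩ := k1
  -- `N = |v|^2`, `S` = imaginary part, `P = v* A v`
  have nn : ∀ s t : ℝ, s ≠ 0 ∨ t ≠ 0 ∨ (s = 0 ∧ t = 0) := by intro s t; tauto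
  have hQ0 : ∀ s t : ℝ, 0 ≤ a * s ^ 2 + 2 * b * s * t + c * t ^ 2 := by
    intro s t
    by_cases hst : s ≠ 0 ∨ t ≠ 0
    · exact (quad_pos_aux a b c s t ha hd hst).le
    · push Not at hst
      simp [hst.1, hst.2]
  have hor : (x ≠ 0 ∨ y ≠ 0) ∨ (x' ≠ 0 ∨ y' ≠ 0) := by tauto
  have hP : 0 < (a * x ^ 2 + 2 * b * x * y + c * y ^ 2)
      + (a * x' ^ 2 + 2 * b * x' * y' + c * y' ^ 2) := by
    rcases hor with h | h
    · exact add_pos_of_pos_of_nonneg (quad_pos_aux a b c _ _ ha hd h) (hQ0 _ _)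
    · exact add_pos_of_nonneg_of_pos (hQ0 _ _) (quad_pos_aux a b c _ _ ha hd h)
  have hN : 0 < x ^ 2 + y ^ 2 + (x' ^ 2 + y' ^ 2) := by
    rcases hor with (h | h) | (h | h) <;> positivity
  set P := (a * x ^ 2 + 2 * b * x * y + c * y ^ 2)
      + (a * x' ^ 2 + 2 * b * x' * y' + c * y' ^ 2) with hPd
  set R := α * (x ^ 2 + y ^ 2 + (x' ^ 2 + y' ^ 2)) with hRd
  set S := 2 * β * (y * x' - x * y') with hSd
  have hR : 0 < R := mul_pos hα hN
  have e1 : l * R - m * S = P := by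
    rw [hRd, hSd, hPd]
    linear_combination -x * p1 - x' * p2 - y * q1 - y' * q2
  have e2 : l * S + m * R = 0 := by
    rw [hRd, hSd]
    linear_combination -x * p2 + x' * p1 - y * q2 + y' * q1
  have e3 : l * (R ^ 2 + S ^ 2) = P * R := by
    linear_combination R * e1 + S * e2
  have : 0 < l * (R ^ 2 + S ^ 2) := by rw [e3]; positivity
  exact pos_of_mul_pos_left this (by positivity)
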